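/- arXiv:1906.12054 — 2 statements merged into one kernel-verified Lean document; each statement's English description precedes it below -/
import Mathlib

section
/- Let F_q be a finite field of odd order q with q > 17 and 3 ∤ q−1, let λ ∈ F_q be a non-square element, and let f = X³ + a ∈ F_q[X]. If the equational graph G(λ,f) is connected, then G(λ,f) has no Hamiltonian cycle of Type 1. -/
open Polynomial

/-- Edge relation of the equational graph `G(l, f)` over a field:
there is an edge from `x` to `y` iff `(y² - f(x))·(l·y² - f(x)) = 0`. -/
def EqEdge {F : Type*} [Field F] (l : F) (f : Polynomial F) (x y : F) : Prop :=
  (y ^ 2 - f.eval x) * (l * y ^ 2 - f.eval x) = 0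

/-- Weak reachability: reachability in the underlying undirected graph. -/
def WeakReach {V : Type*} (E : V → V → Prop) : V → V → Prop :=
  Relation.ReflTransGen fun u v => E u v ∨ E v u

/-- The weakly connected component of a vertex. -/
def WeakComp {V : Type*} (E : V → V → Prop) (x : V) : Set V :=
  {y | WeakReach E x y}

/-- A directed cycle of length `n ≥ 1`, visiting `n` distinct vertices. -/
def IsCycle {V : Type*} (E : V → V → Prop) (n : ℕ) (v : ZMod n → V) : Prop :=
  0 < n ∧ Function.Injective v ∧ ∀ i, E (v i) (v (i + 1))

/-- A directed path with `m` edges and `m + 1` distinct vertices `v 0, v 1, ..., v m`. -/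
def IsPathOn {V : Type*} (E : V → V → Prop) (m : ℕ) (v : ℕ → V) : Prop :=
  (∀ i < m, E (v i) (v (i + 1))) ∧ ∀ i ≤ m, ∀ j ≤ m, v i = v j → i = j

open Classical in
/-- The weight of the edge `(x, y)` in `G(l, f)`: `0` if `y² = f(x)`, and `1` otherwise. -/
noncomputable def wt {F : Type*} [Field F] (l : F) (f : Polynomial F) (x y : F) : ℕ :=
  if y ^ 2 = f.eval x then 0 else 1

/-- A sequence `w` of `m` edge weights contains a trail of length `n`
(`n` consecutive edges of the same weight). -/
def ContainsTrail (w : ℕ → ℕ) (m n : ℕ) : Prop :=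
  ∃ i, i + n ≤ m ∧ ∀ k < n, w (i + k) = w i

/-- A path with `m` edges whose weights are given by `w` is of Type `n`:
it contains a trail of length `n` but none of greater length. -/
def PathTypeN (w : ℕ → ℕ) (m n : ℕ) : Prop :=
  ContainsTrail w m n ∧ ∀ k, n < k → ¬ ContainsTrail w m k

/-- `c` is a Hamiltonian cycle of the (connected) equational graph `G(l, f)` which is of
Type `n`, i.e. removing the vertex `0` from the cycle leaves a path of Type `n`. -/
def IsHamCycleOfType {F : Type*} [Field F] [Fintype F] (l : F) (f : Polynomial F)
    (c : ZMod (Fintype.card F) → F) (n : ℕ) : Prop :=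
  Function.Bijective c ∧ (∀ i, EqEdge l f (c i) (c (i + 1))) ∧
  ∃ i0 : ZMod (Fintype.card F), c i0 = 0 ∧
    PathTypeN (fun k => wt l f (c (i0 + 1 + (k : ZMod (Fintype.card F))))
      (c (i0 + 1 + (k : ZMod (Fintype.card F)) + 1))) (Fintype.card F - 2) n

open Classical in
/-- The quadratic character of a field: `1` on non-zero squares, `-1` on non-squares,
and `qchar 0 = 0`. -/
noncomputable def qchar {F : Type*} [Field F] (u : F) : ℤ :=
  if u = 0 then 0 else if ∃ z : F, z ^ 2 = u then 1 else -1

theorem cube_bijective {F : Type*} [Field F] [Fintype F] (h3 : ¬ (3 ∣ (Fintype.card F - 1))) :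
    Function.Bijective fun x : F => x ^ 3 := by
  have hcop : (Nat.card Fˣ).Coprime 3 := by
    rw [Nat.card_units, Nat.card_eq_fintype_card]
    exact ((Nat.Prime.coprime_iff_not_dvd Nat.prime_three).2 h3).symm
  refine Finite.injective_iff_bijective.1 fun x y hxy => ?_
  rcases eq_or_ne x 0 with rfl | hx
  · exact (pow_eq_zero_iff three_ne_zero |>.1 (by simpa using hxy.symm)).symm
  rcases eq_or_ne y 0 with rfl | hy
  · exact pow_eq_zero_iff three_ne_zero |>.1 (by simpa using hxy)
  · have h : Units.mk0 x hx = Units.mk0 y hy := by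
      refine (powCoprime hcop).injective (Units.ext ?_)
      simpa using hxy
    simpa using congrArg Units.val h

/-- The conic `t² + s² = a²` has a point avoiding `s = 0`, `t = 0` and `t = ±b`. -/
theorem exists_sq_sub_sq_eq_sq {F : Type*} [Field F] [Fintype F] (h2 : (2 : F) ≠ 0)
    (hq : 9 < Fintype.card F) {a b : F} (ha : a ≠ 0) (hb : b ≠ 0) :
    ∃ t s : F, a ^ 2 - t ^ 2 = s ^ 2 ∧ s ≠ 0 ∧ t ≠ 0 ∧ t ≠ b ∧ t ≠ -b := by
  let P : F[X] := X * (X ^ 2 + C 1) * (X ^ 2 - C 1) * (C b * (X ^ 2 + C 1) - C (2 * a) * X) *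
    (C b * (X ^ 2 + C 1) + C (2 * a) * X)
  have hdeg : P.natDegree = 9 := by
    simp only [P]
    compute_degree!
  have hP : P ≠ 0 := by
    intro h
    simp [h] at hdeg
  obtain ⟨m, hm⟩ : ∃ m, P.eval m ≠ 0 := by
    by_contra! h
    refine hP (Polynomial.eq_zero_of_natDegree_lt_card_of_eval_eq_zero P
      (f := id) Function.injective_id (fun m => h m) ?_)
    omega
  simp only [P, eval_mul, eval_add, eval_sub, eval_pow, eval_X, eval_C, mul_ne_zero_iff] at hm
  obtain ⟨⟨⟨⟨hm0, hm1⟩, hm2⟩, hm3⟩, hm4⟩ := hm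
  refine ⟨2 * a * m / (m ^ 2 + 1), a * (m ^ 2 - 1) / (m ^ 2 + 1), ?_, ?_, ?_, ?_, ?_⟩
  · field_simp
    ring
  · exact div_ne_zero (mul_ne_zero ha hm2) hm1
  · exact div_ne_zero (mul_ne_zero (mul_ne_zero h2 ha) hm0) hm1
  · rw [Ne, div_eq_iff hm1]
    exact fun h => hm3 (by rw [h, sub_self])
  · rw [Ne, div_eq_iff hm1]
    exact fun h => hm4 (by rw [h]; ring)

theorem wt_ne_of_pathTypeN_one {V : Type*} {N : ℕ} (hN : 3 < N) {w : V → V → ℕ} {c : ZMod N → V}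
    {i₀ : ZMod N}
    (h : PathTypeN (fun k => w (c (i₀ + 1 + (k : ZMod N))) (c (i₀ + 1 + (k : ZMod N) + 1)))
      (N - 2) 1)
    {i : ZMod N} (hi : i ≠ i₀) (hi1 : i ≠ i₀ + 1) (hi2 : i + 1 ≠ i₀) :
    w (c (i - 1)) (c i) ≠ w (c i) (c (i + 1)) := by
  have : NeZero N := ⟨by omega⟩
  obtain ⟨n, hn, hin⟩ : ∃ n < N, i = i₀ + 1 + (n : ZMod N) :=
    ⟨(i - i₀ - 1).val, ZMod.val_lt _, by rw [ZMod.natCast_zmod_val]; ring⟩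
  have hn0 : n ≠ 0 := by
    rintro rfl
    simp [hin] at hi1
  obtain ⟨k, rfl⟩ := Nat.exists_eq_succ_of_ne_zero hn0
  have hk1 : k + 2 ≠ N := fun hk => hi <| by
    have : ((k + 2 : ℕ) : ZMod N) = 0 := by rw [hk, ZMod.natCast_self]
    push_cast at this hin
    linear_combination hin + this
  have hk2 : k + 3 ≠ N := fun hk => hi2 <| by
    have : ((k + 3 : ℕ) : ZMod N) = 0 := by rw [hk, ZMod.natCast_self]
    push_cast at this hin
    linear_combination hin + this
  intro hw
  refine h.2 2 one_lt_two ⟨k, by omega, fun j hj => ?_⟩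
  interval_cases j
  · rfl
  · have e : i₀ + 1 + ((k + 1 : ℕ) : ZMod N) = i := hin.symm
    have e' : i₀ + 1 + (k : ZMod N) = i - 1 := by
      push_cast at e
      linear_combination e
    simp only [e, e', sub_add_cancel]
    exact hw.symm

theorem wt_eq_zero_or_one {F : Type*} [Field F] (l : F) (f : F[X]) (x y : F) :
    wt l f x y = 0 ∨ wt l f x y = 1 := by
  unfold wt
  split_ifs <;> simp

theorem EqEdge.eval_eq_ite {F : Type*} [Field F] {l : F} {f : F[X]} {x y : F}
    (h : EqEdge l f x y) : f.eval x = if wt l f x y = 0 then y ^ 2 else l * y ^ 2 := by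
  rcases mul_eq_zero.1 h with h | h
  · simp [wt, sub_eq_zero.1 h]
  · by_cases h' : y ^ 2 = f.eval x
    · simp [wt, h']
    · simp [wt, h', sub_eq_zero.1 h]

/-- For a non-square `l`, the weight of an edge leaving `x` is `0` exactly when `f(x)` is a
square. -/
theorem EqEdge.wt_eq_zero_iff {F : Type*} [Field F] {l : F} (hl : ∀ z : F, z ^ 2 ≠ l) {f : F[X]}
    {x y : F} (h : EqEdge l f x y) : wt l f x y = 0 ↔ IsSquare (f.eval x) := by
  have he := h.eval_eq_ite
  constructor
  · intro hw
    rw [if_pos hw] at he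
    exact he ▸ IsSquare.sq y
  · rintro ⟨z, hz⟩
    by_contra hw
    rw [if_neg hw, hz] at he
    have hy : y ≠ 0 := by
      rintro rfl
      have hz0 : f.eval x = 0 := by simpa [hz] using he
      simp [wt, hz0] at hw
    refine hl (z / y) ?_
    rw [div_pow, div_eq_iff (pow_ne_zero 2 hy)]
    linear_combination he

theorem IsHamCycleOfType.ne_one {F : Type*} [Field F] [Fintype F]
    (h2 : (2 : F) ≠ 0) (hq : 9 < Fintype.card F) (h3 : ¬ (3 ∣ (Fintype.card F - 1)))
    {l : F} (hl : ∀ z : F, z ^ 2 ≠ l) {a : F} {c : ZMod (Fintype.card F) → F} {n : ℕ}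
    (hc : IsHamCycleOfType l (X ^ 3 + C a) c n) : n ≠ 1 := by
  rintro rfl
  obtain ⟨hbij, hedge, i₀, hi₀, htype⟩ := hc
  set f : F[X] := X ^ 3 + C a with hf
  have hfe : ∀ x, f.eval x = x ^ 3 + a := fun x => by simp [hf]
  have hcube := cube_bijective h3
  have hl0 : l ≠ 0 := fun h => hl 0 (by simp [h])
  have hlast : ∀ i, f.eval (c i) ≠ 0 → i + 1 ≠ i₀ := by
    intro i hi h
    have := (hedge i).eval_eq_ite
    rw [h, hi₀] at this
    exact hi (by simpa using this)
  have hb : c (i₀ + 1) ≠ 0 := fun h => by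
    have : Fact (1 < Fintype.card F) := ⟨by omega⟩
    simpa using hbij.1 (h.trans hi₀.symm)
  have ha : a ≠ 0 := by
    rintro rfl
    have := (hedge i₀).eval_eq_ite
    rw [hfe, hi₀] at this
    split_ifs at this
    · exact hb (by simpa using this.symm)
    · exact hb (by simpa [hl0] using this.symm)
  obtain ⟨t, s, hts, hs, ht, htb, htb'⟩ :=
    exists_sq_sub_sq_eq_sq h2 hq ha (pow_ne_zero 3 hb)
  obtain ⟨y, rfl⟩ := hcube.2 t
  simp only at hts ht htb htb'
  have hy : y ≠ 0 := fun h => ht (by simp [h])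
  have hprod : f.eval y * f.eval (-y) = s ^ 2 := by
    rw [hfe, hfe, ← hts]
    ring
  have hprod0 : f.eval y * f.eval (-y) ≠ 0 := hprod ▸ pow_ne_zero 2 hs
  have hfy := left_ne_zero_of_mul hprod0
  have hfy' := right_ne_zero_of_mul hprod0
  obtain ⟨i, hi⟩ := hbij.2 y
  obtain ⟨j, hj⟩ := hbij.2 (-y)
  have hwi := wt_ne_of_pathTypeN_one (by omega) htype (i := i)
    (by rintro rfl; exact hy (hi.symm.trans hi₀))
    (by rintro rfl; exact htb (by rw [hi]))
    (hlast i (by rwa [hi]))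
  have hwj := wt_ne_of_pathTypeN_one (by omega) htype (i := j)
    (by rintro rfl; exact hy (neg_eq_zero.1 (hj.symm.trans hi₀)))
    (by rintro rfl; exact htb' (by rw [hj]; ring))
    (hlast j (by rwa [hj]))
  have hout : wt l f (c i) (c (i + 1)) = 0 ↔ wt l f (c j) (c (j + 1)) = 0 := by
    rw [(hedge i).wt_eq_zero_iff hl, (hedge j).wt_eq_zero_iff hl, hi, hj]
    constructor
    · intro h
      rw [eq_div_of_mul_eq hfy ((mul_comm _ _).trans hprod)]
      exact (IsSquare.sq s).div h
    · intro h
      rw [eq_div_of_mul_eq hfy' hprod]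
      exact (IsSquare.sq s).div h
  have hin : wt l f (c (i - 1)) (c i) = wt l f (c (j - 1)) (c j) := by
    have := wt_eq_zero_or_one l f
    rcases this (c (i - 1)) (c i) with h1 | h1 <;> rcases this (c (j - 1)) (c j) with h2 | h2 <;>
    rcases this (c i) (c (i + 1)) with h3 | h3 <;> rcases this (c j) (c (j + 1)) with h4 | h4 <;>
    simp_all
  have hei := (hedge (i - 1)).eval_eq_ite
  have hej := (hedge (j - 1)).eval_eq_ite
  rw [sub_add_cancel] at hei hej
  rw [hin, hi, hfe] at hei
  rw [hj, neg_sq, hfe, ← hj, ← hei] at hej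
  have hij : i = j :=
    sub_left_injective (hbij.1 (hcube.1 (add_right_cancel hej))).symm
  rw [← hij, hi] at hj
  have : (2 : F) * y = 0 := by linear_combination hj
  exact (mul_ne_zero h2 hy) this

/-- for `q > 17` with `3 ∤ q - 1` and `f = X³ + a`, a connected `G(l, f)`
has no Hamiltonian cycle of Type 1. -/
theorem stmt8 {F : Type*} [Field F] [Fintype F]
    (hodd : Odd (Fintype.card F)) (hq : 17 < Fintype.card F)
    (h3 : ¬ (3 ∣ (Fintype.card F - 1)))
    (l : F) (hl : ∀ z : F, z ^ 2 ≠ l) (a : F)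
    (hconn : ∀ x y : F, WeakReach (EqEdge l (X ^ 3 + C a)) x y) :
    ¬ ∃ c : ZMod (Fintype.card F) → F, IsHamCycleOfType l (X ^ 3 + C a) c 1 := by
  rintro ⟨c, hc⟩
  have h2 : (2 : F) ≠ 0 := Ring.two_ne_zero fun h =>
    (Nat.not_even_iff_odd.2 hodd) (Nat.even_iff.2 (FiniteField.even_card_of_char_two h))
  exact hc.ne_one h2 (by omega) h3 hl rfl
end

section
/- Let F_q be a finite field of odd order q and let λ ∈ F_q be a non-square element. For any a ∈ F_q with a ≠ 0, the equational graph G(λ, X + a) has a weakly connected component with exactly two vertices if and only if λ ≠ −1 and a = 2(λ + 1)/(λ − 1)². Moreover, if λ ≠ −1 and a = 2(λ + 1)/(λ − 1)², then the two vertices 2/(1 − λ) and 2/(λ − 1) form such a connected component of G(λ, X + a). -/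
open Polynomial

theorem eqEdge_X_add_C {F : Type*} [Field F] {l a x y : F} :
    EqEdge l (X + C a) x y ↔ y ^ 2 = x + a ∨ l * y ^ 2 = x + a := by
  simp [EqEdge, sub_eq_zero]

theorem self_mem_weakComp {V : Type*} (E : V → V → Prop) (x : V) : x ∈ WeakComp E x :=
  Relation.ReflTransGen.refl

theorem WeakComp.mem_of_edge {V : Type*} {E : V → V → Prop} {x u v : V}
    (hu : u ∈ WeakComp E x) (h : E u v) : v ∈ WeakComp E x :=
  Relation.ReflTransGen.tail hu (Or.inl h)

theorem WeakComp.mem_of_edge_rev {V : Type*} {E : V → V → Prop} {x u v : V}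
    (hu : u ∈ WeakComp E x) (h : E v u) : v ∈ WeakComp E x :=
  Relation.ReflTransGen.tail hu (Or.inr h)

theorem weakComp_subset {V : Type*} {E : V → V → Prop} {x : V} {S : Set V} (hx : x ∈ S)
    (hS : ∀ u v, E u v → (u ∈ S ↔ v ∈ S)) : WeakComp E x ⊆ S := by
  intro y hy
  induction hy with
  | refl => exact hx
  | tail _ h ih => exact h.elim (fun h => (hS _ _ h).1 ih) (fun h => (hS _ _ h).2 ih)

theorem two_ne_zero_of_forall_sq_ne {F : Type*} [Field F] [Finite F] {l : F}
    (hl : ∀ z : F, z ^ 2 ≠ l) : (2 : F) ≠ 0 := by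
  intro h
  obtain ⟨z, hz⟩ := FiniteField.isSquare_of_char_two
    (CharP.ringChar_of_prime_eq_zero Nat.prime_two (by exact_mod_cast h)) l
  exact hl z (by rw [hz, sq])

theorem exists_sq_eq_or_mul_sq_eq {F : Type*} [Field F] [Fintype F] {l : F}
    (hl : ∀ z : F, z ^ 2 ≠ l) (c : F) : ∃ y : F, y ^ 2 = c ∨ l * y ^ 2 = c := by
  classical
  have hl0 : l ≠ 0 := fun h => hl 0 (by simp [h])
  have h2 : ringChar F ≠ 2 := fun h =>
    two_ne_zero_of_forall_sq_ne hl (by have := ringChar.Nat.cast_ringChar (R := F); simpa [h])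
  by_cases hc : IsSquare c
  · obtain ⟨y, hy⟩ := hc
    exact ⟨y, Or.inl (by rw [hy, sq])⟩
  have hl' : ¬ IsSquare l := fun ⟨z, hz⟩ => hl z (by rw [hz, sq])
  have hc0 : c ≠ 0 := by rintro rfl; exact hc IsSquare.zero
  have hχ : quadraticChar F (c * l) = 1 := by
    rw [map_mul, quadraticChar_neg_one_iff_not_isSquare.2 hc,
      quadraticChar_neg_one_iff_not_isSquare.2 hl']
    norm_num
  obtain ⟨z, hz⟩ := (quadraticChar_one_iff_isSquare (mul_ne_zero hc0 hl0)).1 hχ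
  refine ⟨z / l, Or.inr ?_⟩
  field_simp
  linear_combination -hz

/-- A component with two vertices has the form `{y, -y}` with `y ≠ 0`. -/
theorem exists_eq_pair_neg_of_ncard_weakComp_eq_two {F : Type*} [Field F] [Fintype F] {l a x : F}
    (hl : ∀ z : F, z ^ 2 ≠ l) (ha : a ≠ 0)
    (h : (WeakComp (EqEdge l (X + C a)) x).ncard = 2) :
    ∃ y : F, y ≠ 0 ∧ WeakComp (EqEdge l (X + C a)) x = {y, -y} := by
  have h2 := two_ne_zero_of_forall_sq_ne hl
  have hne : ∀ y : F, y ≠ 0 → y ≠ -y := fun y hy e =>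
    mul_ne_zero h2 hy (by linear_combination e)
  obtain ⟨p, q, -, hS⟩ := Set.ncard_eq_two.1 h
  have out : ∀ u ∈ WeakComp (EqEdge l (X + C a)) x, u + a ≠ 0 → ∃ y ≠ 0,
      y ∈ WeakComp (EqEdge l (X + C a)) x ∧ -y ∈ WeakComp (EqEdge l (X + C a)) x := by
    intro u hu hua
    obtain ⟨y, hy⟩ := exists_sq_eq_or_mul_sq_eq hl (u + a)
    refine ⟨y, ?_, WeakComp.mem_of_edge hu (eqEdge_X_add_C.2 hy),
      WeakComp.mem_of_edge hu (eqEdge_X_add_C.2 (by simpa using hy))⟩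
    rintro rfl
    exact hua (by simpa [eq_comm] using hy)
  have h0 : (0 : F) ∉ WeakComp (EqEdge l (X + C a)) x := by
    intro h0
    obtain ⟨y, hy0, hy, hy'⟩ := out 0 h0 (by simpa using ha)
    have := hne y hy0
    have := neg_ne_zero.2 hy0
    simp only [hS, Set.mem_insert_iff, Set.mem_singleton_iff] at h0 hy hy'
    grind
  have hx := self_mem_weakComp (EqEdge l (X + C a)) x
  obtain ⟨y, hy0, hy, hy'⟩ := out x hx fun e =>
    h0 (WeakComp.mem_of_edge hx (eqEdge_X_add_C.2 (Or.inl (by simp [e]))))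
  refine ⟨y, hy0, (Set.eq_of_subset_of_ncard_le ?_ ?_).symm⟩
  · rintro z (rfl | rfl) <;> assumption
  · rw [h, Set.ncard_pair (hne y hy0)]

theorem weakComp_eq_pair {F : Type*} [Field F] {l a y : F}
    (hl : ∀ z : F, z ^ 2 ≠ l) (hy0 : y ≠ 0) (h₁ : y ^ 2 = y + a) (h₂ : l * y ^ 2 = -y + a) :
    WeakComp (EqEdge l (X + C a)) y = {y, -y} := by
  have hl0 : l ≠ 0 := fun h => hl 0 (by simp [h])
  have sq_ne : ∀ u v : F, v ≠ 0 → u ^ 2 ≠ l * v ^ 2 := fun u v hv e =>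
    hl (u / v) (by field_simp; linear_combination e)
  apply Set.Subset.antisymm
  · refine weakComp_subset (by simp) fun u v huv => ?_
    rw [eqEdge_X_add_C] at huv
    simp only [Set.mem_insert_iff, Set.mem_singleton_iff]
    constructor
    · rintro (rfl | rfl)
      · rcases huv with h | h
        · exact sq_eq_sq_iff_eq_or_eq_neg.1 (h.trans h₁.symm)
        · have hv : v ≠ 0 := by
            rintro rfl
            exact pow_ne_zero 2 hy0 (by linear_combination h₁ - h)
          exact absurd (h₁.trans h.symm) (sq_ne _ _ hv)
      · rcases huv with h | h
        · exact absurd (h.trans h₂.symm) (sq_ne _ _ hy0)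
        · exact sq_eq_sq_iff_eq_or_eq_neg.1 (mul_left_cancel₀ hl0 (h.trans h₂.symm))
    · intro hv
      have hv2 : v ^ 2 = y ^ 2 := sq_eq_sq_iff_eq_or_eq_neg.2 hv
      rw [hv2] at huv
      exact huv.imp (fun h => by linear_combination h₁ - h) (fun h => by linear_combination h₂ - h)
  · have hy := self_mem_weakComp (EqEdge l (X + C a)) y
    rintro z (rfl | rfl)
    · exact hy
    · exact WeakComp.mem_of_edge hy (eqEdge_X_add_C.2 (Or.inl (by simpa using h₁)))

/-- for `a ≠ 0`, `G(l, X + a)` has a weakly connected component with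
exactly two vertices iff `l ≠ -1` and `a = 2(l+1)/(l-1)²`; in that case the vertices
`2/(1-l)` and `2/(l-1)` form such a component. -/
theorem stmt13 {F : Type*} [Field F] [Fintype F]
    (hodd : Odd (Fintype.card F))
    (l : F) (hl : ∀ z : F, z ^ 2 ≠ l)
    (a : F) (ha : a ≠ 0) :
    ((∃ x : F, Set.ncard (WeakComp (EqEdge l (X + C a)) x) = 2) ↔
      (l ≠ -1 ∧ a = 2 * (l + 1) / (l - 1) ^ 2)) ∧
    (l ≠ -1 → a = 2 * (l + 1) / (l - 1) ^ 2 →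
      WeakComp (EqEdge l (X + C a)) (2 / (1 - l)) = {2 / (1 - l), 2 / (l - 1)}) := by
  have h2 := two_ne_zero_of_forall_sq_ne hl
  have hl1 : l - 1 ≠ 0 := fun h => hl 1 (by linear_combination -h)
  have hl1' : 1 - l ≠ 0 := fun h => hl1 (by linear_combination -h)
  have hy0 : 2 / (1 - l) ≠ 0 := div_ne_zero h2 hl1'
  have hneg : 2 / (l - 1) = -(2 / (1 - l)) := by
    rw [← neg_sub 1 l, div_neg]
  have hcomp : a = 2 * (l + 1) / (l - 1) ^ 2 →
      WeakComp (EqEdge l (X + C a)) (2 / (1 - l)) = {2 / (1 - l), 2 / (l - 1)} := by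
    intro h
    have hsq : (l - 1) ^ 2 = (1 - l) ^ 2 := by ring
    rw [hneg]
    refine weakComp_eq_pair hl hy0 ?_ ?_ <;> rw [h, hsq] <;> field_simp <;> ring
  refine ⟨⟨?_, ?_⟩, fun _ => hcomp⟩
  · rintro ⟨x, hx⟩
    obtain ⟨y, hy0, hS⟩ := exists_eq_pair_neg_of_ncard_weakComp_eq_two hl ha hx
    have hy : y ∈ WeakComp (EqEdge l (X + C a)) x := by simp [hS]
    have h₁ : y ^ 2 - a ∈ WeakComp (EqEdge l (X + C a)) x :=
      WeakComp.mem_of_edge_rev hy (eqEdge_X_add_C.2 (Or.inl (by ring)))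
    have h₂ : l * y ^ 2 - a ∈ WeakComp (EqEdge l (X + C a)) x :=
      WeakComp.mem_of_edge_rev hy (eqEdge_X_add_C.2 (Or.inr (by ring)))
    have hne : (l - 1) * y ^ 2 ≠ 0 := mul_ne_zero hl1 (pow_ne_zero 2 hy0)
    have key : (l + 1) * y ^ 2 = 2 * a ∧ ((l - 1) * y) ^ 2 = 4 := by
      simp only [hS, Set.mem_insert_iff, Set.mem_singleton_iff] at h₁ h₂
      rcases h₁ with h₁ | h₁ <;> rcases h₂ with h₂ | h₂
      · exact absurd (by linear_combination h₂ - h₁) hne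
      · have : (l - 1) * y = -2 := mul_right_cancel₀ hy0 (by linear_combination h₂ - h₁)
        exact ⟨by linear_combination h₁ + h₂, by rw [this]; norm_num⟩
      · have : (l - 1) * y = 2 := mul_right_cancel₀ hy0 (by linear_combination h₂ - h₁)
        exact ⟨by linear_combination h₁ + h₂, by rw [this]; norm_num⟩
      · exact absurd (by linear_combination h₂ - h₁) hne
    obtain ⟨hsum, hdiff⟩ := key
    refine ⟨?_, ?_⟩
    · rintro rfl
      exact mul_ne_zero h2 ha (by linear_combination -hsum)
    · rw [eq_div_iff (pow_ne_zero 2 hl1)]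
      refine mul_left_cancel₀ h2 ?_
      linear_combination (l + 1) * hdiff - (l - 1) ^ 2 * hsum
  · rintro ⟨-, h⟩
    refine ⟨2 / (1 - l), ?_⟩
    rw [hcomp h, hneg, Set.ncard_pair]
    exact fun e => mul_ne_zero h2 hy0 (by linear_combination e)
end
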